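/- Let Λ be a set and let Γ be a subshift of Λ^ω. If the system (Γ, σ) has the shadowing property with respect to the metric d(x,y) = inf{2^{-n} : x_i = y_i for all i < n}, then Γ is a subshift of bounded type. -/

import Mathlib

open Set Filter Topology

/-- The shift map `σ` on `ℕ → Λ`, defined by `σ(x)(n) = x(n+1)`. -/
def shift {Λ : Type*} (x : ℕ → Λ) : ℕ → Λ := fun n => x (n + 1)

/-- The Baire metric `d(x,y) = inf {2^{-n} : x_i = y_i for all i < n}`. -/
noncomputable def bDist {Λ : Type*} (x y : ℕ → Λ) : ℝ :=
  sInf {r : ℝ | ∃ n : ℕ, r = (2 : ℝ)⁻¹ ^ n ∧ ∀ i < n, x i = y i}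

/-- `Γ` is a subshift: a closed, shift-invariant subset of `ℕ → Λ`. -/
def IsSubshift {Λ : Type*} [TopologicalSpace Λ] (Γ : Set (ℕ → Λ)) : Prop :=
  IsClosed Γ ∧ shift '' Γ = Γ

/-- The finite word `w` is allowed in `Γ`: it occurs as a consecutive block in some point of `Γ`. -/
def Allowed {Λ : Type*} (Γ : Set (ℕ → Λ)) (w : List Λ) : Prop :=
  ∃ x ∈ Γ, ∃ i : ℕ, ∀ (j : ℕ) (h : j < w.length), x (i + j) = w.get ⟨j, h⟩

/-- `F` is a basis for the forbidden words of `Γ`: each member of `F` is forbidden, and every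
forbidden word contains a member of `F` as a consecutive (infix) subword. -/
def IsForbiddenBasis {Λ : Type*} (Γ : Set (ℕ → Λ)) (F : Set (List Λ)) : Prop :=
  (∀ w ∈ F, ¬ Allowed Γ w) ∧ ∀ w : List Λ, ¬ Allowed Γ w → ∃ v ∈ F, v <:+: w

/-- `Γ` is a subshift of finite type: it has a finite basis for its forbidden words. -/
def IsSFT {Λ : Type*} (Γ : Set (ℕ → Λ)) : Prop :=
  ∃ F : Set (List Λ), F.Finite ∧ IsForbiddenBasis Γ F

/-- `Γ` is a subshift of bounded type: it has a basis for its forbidden words whose members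
have uniformly bounded length. -/
def IsSBT {Λ : Type*} (Γ : Set (ℕ → Λ)) : Prop :=
  ∃ F : Set (List Λ), (∃ N : ℕ, ∀ w ∈ F, w.length ≤ N) ∧ IsForbiddenBasis Γ F

/-- `(Γ, σ)` has the shadowing property w.r.t. the Baire metric. -/
def HasShadowing {Λ : Type*} (Γ : Set (ℕ → Λ)) : Prop :=
  ∀ ε : ℝ, 0 < ε → ∃ δ : ℝ, 0 < δ ∧
    ∀ x : ℕ → (ℕ → Λ), (∀ i, x i ∈ Γ) →
      (∀ i, bDist (shift (x i)) (x (i + 1)) < δ) →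
      ∃ z ∈ Γ, ∀ i, bDist (shift^[i] z) (x i) < ε

theorem bDist_le_of_agree {Λ : Type*} {x y : ℕ → Λ} {n : ℕ} (h : ∀ i < n, x i = y i) :
    bDist x y ≤ (2 : ℝ)⁻¹ ^ n :=
  csInf_le ⟨0, by rintro r ⟨k, rfl, -⟩; positivity⟩ ⟨n, rfl, h⟩

theorem apply_zero_eq_of_bDist_lt_one {Λ : Type*} {x y : ℕ → Λ} (h : bDist x y < 1) :
    x 0 = y 0 := by
  obtain ⟨r, ⟨n, rfl, hn⟩, hr⟩ := exists_lt_of_csInf_lt (by exact ⟨1, 0, by simp⟩) h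
  rcases Nat.eq_zero_or_pos n with rfl | hpos
  · simp at hr
  · exact hn 0 hpos

theorem shift_iterate_apply {Λ : Type*} (n : ℕ) (x : ℕ → Λ) (k : ℕ) :
    shift^[n] x k = x (n + k) := by
  induction n generalizing x with
  | zero => simp
  | succ n ih => rw [Function.iterate_succ_apply, ih, shift]; congr 1; omega

theorem shift_iterate_mem {Λ : Type*} {Γ : Set (ℕ → Λ)} (hΓ : shift '' Γ = Γ)
    {x : ℕ → Λ} (hx : x ∈ Γ) (n : ℕ) : shift^[n] x ∈ Γ := by
  induction n with
  | zero => exact hx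
  | succ n ih =>
    rw [Function.iterate_succ_apply', ← hΓ]
    exact mem_image_of_mem _ ih

/-- An allowed word is a prefix of some point of a shift-invariant set. -/
theorem Allowed.exists_starting_with {Λ : Type*} {Γ : Set (ℕ → Λ)} (hΓ : shift '' Γ = Γ)
    {w : List Λ} (hw : Allowed Γ w) :
    ∃ x ∈ Γ, ∀ (j : ℕ) (h : j < w.length), x j = w[j] := by
  obtain ⟨x, hx, i, h⟩ := hw
  exact ⟨shift^[i] x, shift_iterate_mem hΓ hx i, fun j hj => by
    rw [shift_iterate_apply]; exact h j hj⟩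

/-- A subshift with the shadowing property is of bounded type. -/
theorem hasShadowing_sbt {Λ : Type*} [TopologicalSpace Λ] [DiscreteTopology Λ]
    (Γ : Set (ℕ → Λ)) (hΓ : IsSubshift Γ) (hsh : HasShadowing Γ) :
    IsSBT Γ := by
  obtain ⟨δ, hδ, H⟩ := hsh 1 one_pos
  obtain ⟨M, hM⟩ := exists_pow_lt_of_lt_one hδ (by norm_num : (2 : ℝ)⁻¹ < 1)
  refine ⟨{v | v.length ≤ M + 1 ∧ ¬ Allowed Γ v}, ⟨M + 1, fun w hw => hw.1⟩,
    fun w hw => hw.2, fun w hw => ?_⟩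
  by_contra hcon
  have hall : ∀ i, Allowed Γ ((w.drop i).take (M + 1)) := fun i => by
    by_contra hi
    exact hcon ⟨_, ⟨List.length_take_le _ _, hi⟩,
      List.IsInfix.trans ⟨[], _, List.take_append_drop _ _⟩ (List.drop_suffix _ _).isInfix⟩
  have hpre : ∀ i, ∃ x ∈ Γ, ∀ j, j < M + 1 → ∀ h : i + j < w.length, x j = w[i + j] := by
    intro i
    obtain ⟨x, hx, h⟩ := (hall i).exists_starting_with hΓ.2
    refine ⟨x, hx, fun j hj hij => ?_⟩
    rw [h j (by simp; omega)]
    simp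
  choose y hyΓ hy using hpre
  -- Follow the prefixes up to the last full window of `w`, then the orbit of its point.
  set K := w.length - (M + 1) with hK
  obtain ⟨z, hz, hzx⟩ := H (fun i => shift^[i - K] (y (min i K)))
    (fun i => shift_iterate_mem hΓ.2 (hyΓ _) _) (fun i => by
      refine (bDist_le_of_agree (n := M) fun j hj => ?_).trans_lt hM
      simp only [shift, shift_iterate_apply]
      rcases lt_or_ge i K with hi | hi
      · rw [min_eq_left hi.le, min_eq_left (Nat.succ_le_of_lt hi),
          Nat.sub_eq_zero_of_le hi.le, Nat.sub_eq_zero_of_le (Nat.succ_le_of_lt hi),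
          zero_add, zero_add, hy i (j + 1) (by omega) (by omega),
          hy (i + 1) j (by omega) (by omega)]
        congr 1
        omega
      · rw [min_eq_right hi, min_eq_right (by omega)]
        congr 1
        omega)
  refine hw ⟨z, hz, 0, fun j hj => ?_⟩
  have h0 := apply_zero_eq_of_bDist_lt_one (hzx j)
  simp only [shift_iterate_apply, add_zero] at h0
  rw [zero_add, h0, hy _ _ (by omega) (by omega), List.get_eq_getElem]
  congr 1
  change min j K + (j - K) = j
  omega
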